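/- Let 1 ≤ p ≤ 2 and q ≥ 1. For all Hermitian matrices Y₁, Y₂ ∈ M_n ⊗ M_m, ‖Y₁ + i Y₂‖_{CL} ≥ ‖Y₁‖_{CL} and ‖Y₁ + i Y₂‖_{CL} ≥ ‖Y₂‖_{CL}. -/

import Mathlib

open scoped Kronecker
open Matrix
open scoped ENNReal NNReal ComplexOrder

noncomputable section

open scoped Classical in
/-- The Schatten `p`-norm of a complex square matrix, `p ∈ [1,∞]` (as an `ℝ≥0∞`).
For finite `p` it equals `(Tr |A|^p)^{1/p}`, computed via the eigenvalues of `Aᴴ * A`;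
for `p = ∞` it is the operator norm (largest singular value). -/
noncomputable def schattenNorm {k : Type*} [Fintype k] [DecidableEq k] (p : ℝ≥0∞)
    (A : Matrix k k ℂ) : ℝ :=
  if p = ⊤ then
    ⨆ i, Real.sqrt ((Matrix.posSemidef_conjTranspose_mul_self A).isHermitian.eigenvalues i)
  else
    (∑ i, (Matrix.posSemidef_conjTranspose_mul_self A).isHermitian.eigenvalues i
        ^ (p.toReal / 2)) ^ (1 / p.toReal)

/-- `r` defined by `1/r = max{1/p, 1/q} - min{1/p, 1/q}` (so `r = ∞` when `p = q`). -/
noncomputable def ncR (p q : ℝ≥0∞) : ℝ≥0∞ := (max p⁻¹ q⁻¹ - min p⁻¹ q⁻¹)⁻¹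

/-- The non-commutative `L^q(L^p)` norm (supremum form, used when `p ≤ q`):
`sup_{A,B} ‖(A ⊗ I) Y (B ⊗ I)‖_p / (‖A‖_{2r} ‖B‖_{2r})`. -/
noncomputable def ncNormSup {k l : Type*} [Fintype k] [DecidableEq k] [Fintype l] [DecidableEq l]
    (p q : ℝ≥0∞) (Y : Matrix (k × l) (k × l) ℂ) : ℝ :=
  ⨆ A : Matrix k k ℂ, ⨆ B : Matrix k k ℂ,
    schattenNorm p ((A ⊗ₖ (1 : Matrix l l ℂ)) * Y * (B ⊗ₖ (1 : Matrix l l ℂ))) /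
      (schattenNorm (2 * ncR p q) A * schattenNorm (2 * ncR p q) B)

/-- The non-commutative `L^q(L^p)` norm (infimum form, used when `q ≤ p`):
`inf { ∑ᵢ ‖Aᵢ‖_{2r} ‖Bᵢ‖_{2r} ‖Zᵢ‖_p : Y = ∑ᵢ (Aᵢ ⊗ I) Zᵢ (Bᵢ ⊗ I) }`. -/
noncomputable def ncNormInf {k l : Type*} [Fintype k] [DecidableEq k] [Fintype l] [DecidableEq l]
    (p q : ℝ≥0∞) (Y : Matrix (k × l) (k × l) ℂ) : ℝ :=
  sInf { s : ℝ | ∃ (N : ℕ) (A B : Fin N → Matrix k k ℂ)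
      (Z : Fin N → Matrix (k × l) (k × l) ℂ),
    Y = ∑ i, (A i ⊗ₖ (1 : Matrix l l ℂ)) * Z i * (B i ⊗ₖ (1 : Matrix l l ℂ)) ∧
    s = ∑ i, schattenNorm (2 * ncR p q) (A i) * schattenNorm (2 * ncR p q) (B i) *
          schattenNorm p (Z i) }

open scoped Classical in
/-- The non-commutative `L^q(L^p)` norm `‖·‖_{NC:p,q}`. -/
noncomputable def ncNorm {k l : Type*} [Fintype k] [DecidableEq k] [Fintype l] [DecidableEq l]
    (p q : ℝ≥0∞) (Y : Matrix (k × l) (k × l) ℂ) : ℝ :=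
  if p ≤ q then ncNormSup p q Y else ncNormInf p q Y

open scoped Classical in
/-- Real power of a Hermitian matrix via the spectral decomposition (junk value `0` on
non-Hermitian matrices). -/
noncomputable def mrpow {k : Type*} [Fintype k] [DecidableEq k] (A : Matrix k k ℂ) (e : ℝ) :
    Matrix k k ℂ :=
  if hA : A.IsHermitian then
    (hA.eigenvectorUnitary : Matrix k k ℂ) *
      Matrix.diagonal (fun i => ((hA.eigenvalues i ^ e : ℝ) : ℂ)) *
      ((hA.eigenvectorUnitary : Matrix k k ℂ))ᴴ
  else 0

/-- Partial trace over the second (inside) factor. -/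
noncomputable def ptrace2 {k l : Type*} [Fintype l]
    (Y : Matrix (k × l) (k × l) ℂ) : Matrix k k ℂ :=
  fun i i' => ∑ j : l, Y (i, j) (i', j)

/-- The Carlen–Lieb quantity `Ψ_{p,q}(Y) = (Tr₁ (Tr₂ Y^p)^{q/p})^{1/q}`. -/
noncomputable def Psi {k l : Type*} [Fintype k] [DecidableEq k] [Fintype l] [DecidableEq l]
    (p q : ℝ) (Y : Matrix (k × l) (k × l) ℂ) : ℝ :=
  (Matrix.trace (mrpow (ptrace2 (mrpow Y p)) (q / p))).re ^ (1 / q)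

/-- The quantity `|||X|||_{p,q} = inf {Ψ_{p,q}(A) + Ψ_{p,q}(B) : X + A = B, A ≥ 0, B ≥ 0}`,
for `X` on the space `M_k ⊗ (M_l ⊗ M_2)`. -/
noncomputable def tripleNorm {k l : Type*} [Fintype k] [DecidableEq k] [Fintype l] [DecidableEq l]
    (p q : ℝ) (X : Matrix (k × (l × Fin 2)) (k × (l × Fin 2)) ℂ) : ℝ :=
  sInf { s : ℝ | ∃ A B : Matrix (k × (l × Fin 2)) (k × (l × Fin 2)) ℂ,
    A.PosSemidef ∧ B.PosSemidef ∧ X + A = B ∧ s = Psi p q A + Psi p q B }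

/-- The block matrix `[[0, Y],[Yᴴ, 0]]`, viewed in `M_k ⊗ (M_l ⊗ M_2)`. -/
noncomputable def clBlock {k l : Type*} (Y : Matrix (k × l) (k × l) ℂ) :
    Matrix (k × (l × Fin 2)) (k × (l × Fin 2)) ℂ :=
  fun x y =>
    if x.2.2 = 0 ∧ y.2.2 = 1 then Y (x.1, x.2.1) (y.1, y.2.1)
    else if x.2.2 = 1 ∧ y.2.2 = 0 then star (Y (y.1, y.2.1) (x.1, x.2.1))
    else 0

/-- The block-diagonal matrix `diag(P, Q) = [[P, 0],[0, Q]]`, viewed in `M_k ⊗ (M_l ⊗ M_2)`. -/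
noncomputable def blockDiag2 {k l : Type*} (P Q : Matrix (k × l) (k × l) ℂ) :
    Matrix (k × (l × Fin 2)) (k × (l × Fin 2)) ℂ :=
  fun x y =>
    if x.2.2 = 0 ∧ y.2.2 = 0 then P (x.1, x.2.1) (y.1, y.2.1)
    else if x.2.2 = 1 ∧ y.2.2 = 1 then Q (x.1, x.2.1) (y.1, y.2.1)
    else 0

/-- The Carlen–Lieb norm `‖Y‖_{CL} = (1/2) ||| [[0,Y],[Yᴴ,0]] |||_{p,q}`. -/
noncomputable def clNorm {k l : Type*} [Fintype k] [DecidableEq k] [Fintype l] [DecidableEq l]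
    (p q : ℝ) (Y : Matrix (k × l) (k × l) ℂ) : ℝ :=
  (1 / 2) * tripleNorm p q (clBlock Y)

end

namespace CFC

open Set MeasureTheory Real

section Convexity

variable {A : Type*} [CStarAlgebra A] [PartialOrder A] [StarOrderedRing A]

/-- `rpowIntegrand₁₂ p t` is operator convex. -/
lemma convexOn_cfc_rpowIntegrand₁₂ {p t : ℝ} (ht : 0 < t) :
    ConvexOn ℝ (Ici (0 : A)) (cfc (rpowIntegrand₁₂ p t)) := by
  have h₁ : (Ici (0 : A)).EqOn (cfc (rpowIntegrand₁₂ p t))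
      (fun x : A => t ^ (p - 1) •
        ((t⁻¹ • x + t • Ring.inverse (algebraMap ℝ A t + x)) - algebraMap ℝ A 1)) := by
    intro x hx
    have hx0 : 0 ≤ x := hx
    unfold rpowIntegrand₁₂
    have hspectrum : ∀ r ∈ spectrum ℝ x, t + r ≠ 0 := by grind
    have hg : ContinuousOn (fun z : ℝ => (t + z)⁻¹) (spectrum ℝ x) := by
      fun_prop (disch := grind -abstractProof)
    have hinv : cfc (fun z : ℝ => (t + z)⁻¹) x = Ring.inverse (algebraMap ℝ A t + x) := by
      rw [cfc_inv (fun z : ℝ => t + z) x hspectrum (by fun_prop), cfc_const_add .., cfc_id' ..]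
    have hg₁ : ContinuousOn (fun z : ℝ => t⁻¹ * z) (spectrum ℝ x) := by fun_prop
    have hg₂ : ContinuousOn (fun z : ℝ => t * (t + z)⁻¹) (spectrum ℝ x) :=
      continuousOn_const.mul hg
    have hg₃ : ContinuousOn (fun z : ℝ => t⁻¹ * z + t * (t + z)⁻¹) (spectrum ℝ x) := hg₁.add hg₂
    have hg₄ : ContinuousOn (fun _ : ℝ => (1 : ℝ)) (spectrum ℝ x) := continuousOn_const
    have hlin : cfc (fun z : ℝ => t⁻¹ * z) x = t⁻¹ • x := by
      rw [cfc_const_mul t⁻¹ (fun z : ℝ => z) x, cfc_id' ..]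
    rw [cfc_const_mul _ (fun z : ℝ => t⁻¹ * z + t * (t + z)⁻¹ - 1) x (hg₃.sub hg₄),
      cfc_sub _ _ x hg₃ hg₄, cfc_const 1 x,
      cfc_add (a := x) _ _ hg₁ hg₂, cfc_const_mul t _ x hg, hinv, hlin]
  refine ConvexOn.congr ?_ h₁.symm
  refine ConvexOn.smul (by positivity) (ConvexOn.sub (ConvexOn.add ?_ ?_) ?_)
  · exact ConvexOn.smul (by positivity) (convexOn_id (convex_Ici 0))
  · exact ConvexOn.smul ht.le (CStarAlgebra.convexOn_ringInverse_algebraMap_add ht)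
  · exact concaveOn_const _ (convex_Ici 0)

lemma convexOn_rpow_Ioo {p : ℝ} (hp : p ∈ Ioo 1 2) :
    ConvexOn ℝ (Ici (0 : A)) (fun a : A => a ^ p) := by
  lift p to NNReal using by grind
  have hp' : p ∈ Ioo 1 2 := by exact_mod_cast hp
  obtain ⟨μ, hμ⟩ := exists_measure_nnrpow_eq_integral_cfcₙ_rpowIntegrand₁₂ A hp'
  have h : (Ici (0 : A)).EqOn (fun a : A => a ^ (p : ℝ))
      (fun a : A => ∫ t in Ioi 0, cfcₙ (rpowIntegrand₁₂ p t) a ∂μ) := fun a ha => by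
    dsimp only
    rw [← nnrpow_eq_rpow (zero_lt_one.trans hp'.1), (hμ a ha).2]
  refine ConvexOn.congr ?_ h.symm
  refine integral_convexOn_of_integrand_ae (convex_Ici _) ?_ fun a ha => (hμ a ha).1
  filter_upwards [ae_restrict_mem measurableSet_Ioi] with t ht
  refine CStarAlgebra.convexOn_cfcₙ_of_convexOn_cfc ((convexOn_cfc_rpowIntegrand₁₂ ht).subset
    CStarAlgebra.inr_map_Ici_zero ?_)
  exact Convex.linear_image (convex_Ici _) (Unitization.inrHom ℝ ℂ A)

lemma convexOn_mul_self : ConvexOn ℝ (Ici (0 : A)) (fun a : A => a * a) := by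
  refine ⟨convex_Ici _, fun x hx y hy a b ha hb hab => ?_⟩
  have hxy : IsSelfAdjoint (x - y) :=
    (IsSelfAdjoint.of_nonneg hx).sub (IsSelfAdjoint.of_nonneg hy)
  rw [← sub_nonneg]
  have : a • (x * x) + b • (y * y) - (a • x + b • y) * (a • x + b • y)
      = (a * b) • (star (x - y) * (x - y)) := by
    rw [hxy.star_eq]
    obtain rfl : b = 1 - a := by linarith
    simp only [add_mul, mul_add, sub_mul, mul_sub, smul_mul_smul_comm]
    module
  dsimp only
  rw [this]
  exact smul_nonneg (mul_nonneg ha hb) (star_mul_self_nonneg _)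

/-- `a ↦ a ^ p` is operator convex for `p ∈ [1, 2]`. -/
lemma convexOn_rpow {p : ℝ} (hp : p ∈ Icc 1 2) :
    ConvexOn ℝ (Ici (0 : A)) (fun a : A => a ^ p) := by
  rcases hp.1.eq_or_lt with rfl | h1
  · exact (convexOn_id (convex_Ici _)).congr fun a ha => (rpow_one a ha).symm
  rcases hp.2.eq_or_lt with rfl | h2
  · refine convexOn_mul_self.congr fun a ha => ?_
    have := rpow_natCast a 2 ha
    push_cast at this
    rw [this, pow_two]
  · exact convexOn_rpow_Ioo ⟨h1, h2⟩

end Convexity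

end CFC
open scoped MatrixOrder Matrix.Norms.L2Operator

section MatrixPower

variable {k : Type*} [Fintype k] [DecidableEq k]

lemma mrpow_eq_cfc {A : Matrix k k ℂ} (hA : A.IsHermitian) (e : ℝ) :
    mrpow A e = cfc (fun x : ℝ => x ^ e) A := by
  rw [mrpow, dif_pos hA, hA.cfc_eq, Matrix.IsHermitian.cfc, Unitary.conjStarAlgAut_apply]
  rfl

lemma mrpow_eq_rpow {A : Matrix k k ℂ} (hA : A.PosSemidef) (e : ℝ) : mrpow A e = A ^ e := by
  rw [mrpow_eq_cfc hA.isHermitian, CFC.rpow_eq_cfc_real hA.nonneg]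

lemma posSemidef_mrpow {A : Matrix k k ℂ} (hA : A.PosSemidef) (e : ℝ) :
    (mrpow A e).PosSemidef := by
  rw [mrpow_eq_rpow hA, ← Matrix.nonneg_iff_posSemidef]
  exact CFC.rpow_nonneg

lemma mrpow_unitary_conj {A U : Matrix k k ℂ} (hA : A.IsHermitian)
    (hU : U ∈ Matrix.unitaryGroup k ℂ) (e : ℝ) :
    mrpow (U * A * Uᴴ) e = U * mrpow A e * Uᴴ := by
  have hUA : (U * A * Uᴴ).IsHermitian := Matrix.isHermitian_mul_mul_conjTranspose U hA
  rw [mrpow_eq_cfc hA, mrpow_eq_cfc hUA]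
  have h := StarAlgHomClass.map_cfc (S := ℝ) (Unitary.conjStarAlgAut ℝ (Matrix k k ℂ) ⟨U, hU⟩)
    (fun x : ℝ => x ^ e) A (Set.Finite.continuousOn Matrix.finite_real_spectrum _)
    (show Continuous fun X : Matrix k k ℂ => U * X * star U by fun_prop) hA.isSelfAdjoint
    hUA.isSelfAdjoint
  simpa [Unitary.conjStarAlgAut_apply, Matrix.star_eq_conjTranspose] using h.symm

lemma mrpow_half_add_le {A B : Matrix k k ℂ} (hA : A.PosSemidef) (hB : B.PosSemidef) {p : ℝ}
    (hp : p ∈ Set.Icc 1 2) :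
    mrpow ((1 / 2 : ℝ) • (A + B)) p ≤ (1 / 2 : ℝ) • (mrpow A p + mrpow B p) := by
  have h := (CFC.convexOn_rpow (A := Matrix k k ℂ) hp).2 hA.nonneg hB.nonneg
    (by norm_num : (0 : ℝ) ≤ 1 / 2) (by norm_num : (0 : ℝ) ≤ 1 / 2) (by norm_num)
  rw [mrpow_eq_rpow hA, mrpow_eq_rpow hB, mrpow_eq_rpow ((hA.add hB).smul (by norm_num)),
    smul_add, smul_add]
  exact h

lemma trace_mrpow {A : Matrix k k ℂ} (hA : A.IsHermitian) (e : ℝ) :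
    (mrpow A e).trace.re = ∑ i, hA.eigenvalues i ^ e := by
  have hU : ((hA.eigenvectorUnitary : Matrix k k ℂ))ᴴ * hA.eigenvectorUnitary = 1 :=
    Unitary.coe_star_mul_self _
  rw [mrpow, dif_pos hA, Matrix.trace_mul_cycle, hU, one_mul, Matrix.trace_diagonal,
    Complex.re_sum]
  simp

/-- The trace function `A ↦ tr (A ^ s)` is monotone on positive semidefinite matrices. -/
lemma trace_mrpow_le_of_one_le {A B : Matrix k k ℂ} (hA : A.PosSemidef) (hB : B.PosSemidef)
    (hAB : A ≤ B) {s : ℝ} (hs : 1 ≤ s) :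
    (mrpow A s).trace.re ≤ (mrpow B s).trace.re := by
  set U : Matrix k k ℂ := hA.isHermitian.eigenvectorUnitary.1
  set V : Matrix k k ℂ := hB.isHermitian.eigenvectorUnitary.1
  set a := hA.isHermitian.eigenvalues
  set b := hB.isHermitian.eigenvalues
  have hUU : Uᴴ * U = 1 := Unitary.coe_star_mul_self hA.isHermitian.eigenvectorUnitary
  have hUU' : U * Uᴴ = 1 := Unitary.coe_mul_star_self hA.isHermitian.eigenvectorUnitary
  have hVV : Vᴴ * V = 1 := Unitary.coe_star_mul_self hB.isHermitian.eigenvectorUnitary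
  have hVV' : V * Vᴴ = 1 := Unitary.coe_mul_star_self hB.isHermitian.eigenvectorUnitary
  have hAd : A = U * diagonal (fun i => (a i : ℂ)) * Uᴴ := by
    conv_lhs => rw [hA.isHermitian.spectral_theorem, Unitary.conjStarAlgAut_apply]
    rfl
  have hBd : B = V * diagonal (fun i => (b i : ℂ)) * Vᴴ := by
    conv_lhs => rw [hB.isHermitian.spectral_theorem, Unitary.conjStarAlgAut_apply]
    rfl
  set W : Matrix k k ℂ := Vᴴ * U with hW
  have hWW : Wᴴ * W = 1 := by
    rw [hW, conjTranspose_mul, conjTranspose_conjTranspose,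
      show Uᴴ * V * (Vᴴ * U) = Uᴴ * (V * Vᴴ) * U by simp only [mul_assoc], hVV', mul_one, hUU]
  have hWW' : W * Wᴴ = 1 := by
    rw [hW, conjTranspose_mul, conjTranspose_conjTranspose,
      show Vᴴ * U * (Uᴴ * V) = Vᴴ * (U * Uᴴ) * V by simp only [mul_assoc], hUU', mul_one, hVV]
  have hcol (j : k) : ∑ i, ‖W i j‖ ^ 2 = 1 := by
    have := congrFun (congrFun hWW j) j
    simp only [mul_apply, conjTranspose_apply, Complex.star_def, Complex.conj_mul', one_apply_eq]
      at this
    exact_mod_cast this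
  have hrow (i : k) : ∑ j, ‖W i j‖ ^ 2 = 1 := by
    have := congrFun (congrFun hWW' i) i
    simp only [mul_apply, conjTranspose_apply, Complex.star_def, Complex.mul_conj', one_apply_eq]
      at this
    exact_mod_cast this
  have hle (j : k) : a j ≤ ∑ i, ‖W i j‖ ^ 2 * b i := by
    have h1 : (Uᴴ * (B - A) * U).PosSemidef :=
      (Matrix.le_iff.1 hAB).conjTranspose_mul_mul_same U
    have h2 : Uᴴ * (B - A) * U = Wᴴ * diagonal (fun i => (b i : ℂ)) * W
        - diagonal (fun i => (a i : ℂ)) := by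
      have h3 : Uᴴ * A * U = diagonal (fun i => (a i : ℂ)) := by
        conv_lhs => rw [hAd]
        rw [show Uᴴ * (U * diagonal (fun i => (a i : ℂ)) * Uᴴ) * U =
          (Uᴴ * U) * diagonal (fun i => (a i : ℂ)) * (Uᴴ * U) by simp only [mul_assoc], hUU,
          one_mul, mul_one]
      have h4 : Uᴴ * B * U = Wᴴ * diagonal (fun i => (b i : ℂ)) * W := by
        conv_lhs => rw [hBd]
        simp only [hW, conjTranspose_mul, conjTranspose_conjTranspose, mul_assoc]
      rw [mul_sub, sub_mul, h3, h4]
    have h5 := h1.diag_nonneg (i := j)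
    rw [h2, Matrix.sub_apply, diagonal_apply_eq, mul_apply] at h5
    have h6 : ∑ i, (Wᴴ * diagonal (fun i => (b i : ℂ))) j i * W i j
        = ((∑ i, ‖W i j‖ ^ 2 * b i : ℝ) : ℂ) := by
      push_cast
      refine Finset.sum_congr rfl fun i _ => ?_
      rw [mul_diagonal, conjTranspose_apply, Complex.star_def, mul_right_comm, Complex.conj_mul']
    rw [h6, sub_nonneg] at h5
    exact_mod_cast h5
  rw [trace_mrpow hA.isHermitian, trace_mrpow hB.isHermitian]
  calc ∑ j, a j ^ s ≤ ∑ j, ∑ i, ‖W i j‖ ^ 2 * b i ^ s := by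
        refine Finset.sum_le_sum fun j _ => ?_
        exact (Real.rpow_le_rpow (hA.eigenvalues_nonneg j) (hle j) (by linarith)).trans
          (Real.rpow_arith_mean_le_arith_mean_rpow _ _ _ (fun i _ => by positivity) (hcol j)
            (fun i _ => hB.eigenvalues_nonneg i) hs)
    _ = ∑ i, b i ^ s := by
        rw [Finset.sum_comm]
        simp_rw [← Finset.sum_mul, hrow, one_mul]

lemma trace_mrpow_le {A B : Matrix k k ℂ} (hA : A.PosSemidef) (hB : B.PosSemidef)
    (hAB : A ≤ B) {s : ℝ} (hs : 0 ≤ s) :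
    (mrpow A s).trace.re ≤ (mrpow B s).trace.re := by
  rcases le_total 1 s with h1 | h1
  · exact trace_mrpow_le_of_one_le hA hB hAB h1
  · have h : mrpow A s ≤ mrpow B s := by
      rw [mrpow_eq_rpow hA, mrpow_eq_rpow hB]
      exact CFC.rpow_le_rpow ⟨hs, h1⟩ hAB
    have := (Complex.le_def.1 (Matrix.le_iff.1 h).trace_nonneg).1
    rw [trace_sub, Complex.sub_re] at this
    simpa using this

end MatrixPower

section PartialTrace

variable {k l : Type*}

lemma ptrace2_add [Fintype l] (X Y : Matrix (k × l) (k × l) ℂ) :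
    ptrace2 (X + Y) = ptrace2 X + ptrace2 Y := by
  ext i j
  simp [ptrace2, Finset.sum_add_distrib]

lemma ptrace2_smul [Fintype l] (c : ℝ) (X : Matrix (k × l) (k × l) ℂ) :
    ptrace2 (c • X) = c • ptrace2 X := by
  ext i j
  simp [ptrace2, Finset.mul_sum]

lemma posSemidef_ptrace2 [Fintype k] [Fintype l] {Y : Matrix (k × l) (k × l) ℂ}
    (hY : Y.PosSemidef) : (ptrace2 Y).PosSemidef := by
  have h : ptrace2 Y = ∑ j : l, Y.submatrix (fun i => (i, j)) (fun i => (i, j)) := by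
    ext i i'
    simp [ptrace2, Matrix.sum_apply]
  rw [h]
  exact Matrix.posSemidef_sum _ fun j _ => hY.submatrix _

lemma ptrace2_mono [Fintype k] [Fintype l] {X Y : Matrix (k × l) (k × l) ℂ} (h : X ≤ Y) :
    ptrace2 X ≤ ptrace2 Y := by
  have hY : Y = X + (Y - X) := by abel
  rw [hY, ptrace2_add]
  exact le_add_of_nonneg_right (posSemidef_ptrace2 (Matrix.le_iff.1 h)).nonneg

variable [Fintype k] [DecidableEq k] [Fintype l] [DecidableEq l]

omit [DecidableEq l] in
lemma one_kronecker_conj_apply (v : Matrix l l ℂ) (Y : Matrix (k × l) (k × l) ℂ) (i i' : k)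
    (j j' : l) :
    (((1 : Matrix k k ℂ) ⊗ₖ v) * Y * ((1 : Matrix k k ℂ) ⊗ₖ v)ᴴ) (i, j) (i', j')
      = (v * Y.submatrix (fun a => (i, a)) (fun a => (i', a)) * vᴴ) j j' := by
  simp [Matrix.mul_apply, Fintype.sum_prod_type, Matrix.one_apply, Finset.sum_ite_irrel,
    ite_mul, mul_ite, apply_ite star, Finset.sum_ite_eq]

lemma ptrace2_one_kronecker_conj {v : Matrix l l ℂ} (hv : v ∈ Matrix.unitaryGroup l ℂ)
    (Y : Matrix (k × l) (k × l) ℂ) :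
    ptrace2 (((1 : Matrix k k ℂ) ⊗ₖ v) * Y * ((1 : Matrix k k ℂ) ⊗ₖ v)ᴴ) = ptrace2 Y := by
  ext i i'
  have hv' : vᴴ * v = 1 := Matrix.mem_unitaryGroup_iff'.1 hv
  simp only [ptrace2, one_kronecker_conj_apply]
  change (v * Y.submatrix (fun a => (i, a)) (fun a => (i', a)) * vᴴ).trace = _
  rw [Matrix.trace_mul_cycle, hv', one_mul]
  rfl

lemma one_kronecker_mem_unitaryGroup {v : Matrix l l ℂ} (hv : v ∈ Matrix.unitaryGroup l ℂ) :
    (1 : Matrix k k ℂ) ⊗ₖ v ∈ Matrix.unitaryGroup (k × l) ℂ :=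
  Matrix.kronecker_mem_unitary (one_mem _) hv

lemma Psi_nonneg {Y : Matrix (k × l) (k × l) ℂ} (hY : Y.PosSemidef) (p q : ℝ) :
    0 ≤ Psi p q Y :=
  Real.rpow_nonneg (Complex.le_def.1 (posSemidef_mrpow
    (posSemidef_ptrace2 (posSemidef_mrpow hY p)) (q / p)).trace_nonneg).1 _

/-- The average of the conjugates of `Y` by two matrices acting on the inside factor. -/
noncomputable def insideAverage (v w : Matrix l l ℂ) (Y : Matrix (k × l) (k × l) ℂ) :
    Matrix (k × l) (k × l) ℂ :=
  (1 / 2 : ℝ) • (((1 : Matrix k k ℂ) ⊗ₖ v) * Y * ((1 : Matrix k k ℂ) ⊗ₖ v)ᴴ +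
    ((1 : Matrix k k ℂ) ⊗ₖ w) * Y * ((1 : Matrix k k ℂ) ⊗ₖ w)ᴴ)

lemma insideAverage_add (v w : Matrix l l ℂ) (X Y : Matrix (k × l) (k × l) ℂ) :
    insideAverage v w (X + Y) = insideAverage v w X + insideAverage v w Y := by
  simp only [insideAverage, mul_add, add_mul, ← smul_add]
  congr 1
  abel

omit [DecidableEq l] in
lemma Matrix.PosSemidef.insideAverage {Y : Matrix (k × l) (k × l) ℂ} (hY : Y.PosSemidef)
    (v w : Matrix l l ℂ) : (insideAverage v w Y).PosSemidef :=
  ((hY.mul_mul_conjTranspose_same _).add (hY.mul_mul_conjTranspose_same _)).smul (by norm_num)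

lemma Psi_insideAverage_le {v w : Matrix l l ℂ} (hv : v ∈ Matrix.unitaryGroup l ℂ)
    (hw : w ∈ Matrix.unitaryGroup l ℂ) {Y : Matrix (k × l) (k × l) ℂ} (hY : Y.PosSemidef)
    {p q : ℝ} (hp : p ∈ Set.Icc 1 2) (hq : 0 ≤ q) :
    Psi p q (insideAverage v w Y) ≤ Psi p q Y := by
  have hZ := hY.insideAverage v w
  have hle : ptrace2 (mrpow (insideAverage v w Y) p) ≤ ptrace2 (mrpow Y p) := by
    refine (ptrace2_mono (mrpow_half_add_le (hY.mul_mul_conjTranspose_same _)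
      (hY.mul_mul_conjTranspose_same _) hp)).trans_eq ?_
    rw [mrpow_unitary_conj hY.isHermitian (one_kronecker_mem_unitaryGroup hv),
      mrpow_unitary_conj hY.isHermitian (one_kronecker_mem_unitaryGroup hw),
      ptrace2_smul, ptrace2_add, ptrace2_one_kronecker_conj hv, ptrace2_one_kronecker_conj hw]
    module
  have hp0 : 0 ≤ p := zero_le_one.trans hp.1
  have hP := posSemidef_ptrace2 (posSemidef_mrpow hZ p)
  refine Real.rpow_le_rpow ?_ (trace_mrpow_le hP
    (posSemidef_ptrace2 (posSemidef_mrpow hY p)) hle (by positivity)) (by positivity)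
  exact (Complex.le_def.1 (posSemidef_mrpow hP _).trace_nonneg).1

end PartialTrace

section CarlenLieb

variable {k l : Type*} [Fintype k] [DecidableEq k] [Fintype l] [DecidableEq l]

lemma tripleNorm_insideAverage_le {v w : Matrix (l × Fin 2) (l × Fin 2) ℂ}
    (hv : v ∈ Matrix.unitaryGroup (l × Fin 2) ℂ) (hw : w ∈ Matrix.unitaryGroup (l × Fin 2) ℂ)
    {X : Matrix (k × (l × Fin 2)) (k × (l × Fin 2)) ℂ} (hX : X.IsHermitian)
    {p q : ℝ} (hp : p ∈ Set.Icc 1 2) (hq : 0 ≤ q) :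
    tripleNorm p q (insideAverage v w X) ≤ tripleNorm p q X := by
  refine le_csInf ?_ ?_
  · refine ⟨_, X⁻, X⁺, Matrix.nonneg_iff_posSemidef.1 (CFC.negPart_nonneg X),
      Matrix.nonneg_iff_posSemidef.1 (CFC.posPart_nonneg X), ?_, rfl⟩
    exact eq_sub_iff_add_eq.1 (CFC.posPart_sub_negPart X hX.isSelfAdjoint).symm
  · rintro s ⟨A, B, hA, hB, rfl, rfl⟩
    have hle : tripleNorm p q (insideAverage v w X) ≤
        Psi p q (insideAverage v w A) + Psi p q (insideAverage v w (X + A)) := by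
      refine csInf_le ⟨0, ?_⟩ ⟨_, _, hA.insideAverage v w, hB.insideAverage v w,
        (insideAverage_add v w X A).symm, rfl⟩
      rintro s ⟨A', B', hA', hB', -, rfl⟩
      exact add_nonneg (Psi_nonneg hA' p q) (Psi_nonneg hB' p q)
    exact hle.trans
      (add_le_add (Psi_insideAverage_le hv hw hA hp hq) (Psi_insideAverage_le hv hw hB hp hq))

omit [Fintype k] [DecidableEq k] [Fintype l] [DecidableEq l] in
lemma isHermitian_clBlock (Y : Matrix (k × l) (k × l) ℂ) : (clBlock Y).IsHermitian := by
  ext ⟨a, b, i⟩ ⟨a', b', j⟩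
  fin_cases i <;> fin_cases j <;> simp [clBlock]

/-- Conjugating with `diag(1, z)` and averaging with the conjugate by the swapped matrix turns
`clBlock Y` into `clBlock` of the Hermitian part of `star z • Y`. -/
lemma insideAverage_clBlock (z : ℂ) (Y : Matrix (k × l) (k × l) ℂ) :
    insideAverage ((1 : Matrix l l ℂ) ⊗ₖ !![1, 0; 0, z]) ((1 : Matrix l l ℂ) ⊗ₖ !![0, z; 1, 0])
      (clBlock Y) = clBlock ((1 / 2 : ℝ) • (star z • Y + z • Yᴴ)) := by
  ext ⟨a, b, i⟩ ⟨a', b', j⟩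
  have h (w : Matrix (Fin 2) (Fin 2) ℂ) :
      (((1 : Matrix k k ℂ) ⊗ₖ ((1 : Matrix l l ℂ) ⊗ₖ w)) * clBlock Y *
        ((1 : Matrix k k ℂ) ⊗ₖ ((1 : Matrix l l ℂ) ⊗ₖ w))ᴴ) (a, b, i) (a', b', j)
      = (w * (clBlock Y).submatrix (fun c => (a, b, c)) (fun c => (a', b', c)) * wᴴ) i j := by
    rw [one_kronecker_conj_apply, one_kronecker_conj_apply]
    rfl
  rw [insideAverage, Matrix.smul_apply, Matrix.add_apply, h, h]
  simp only [Matrix.mul_apply, Fin.sum_univ_two]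
  fin_cases i <;> fin_cases j <;> simp [clBlock, mul_comm, add_comm]

lemma clNorm_hermitianPart_le {z : ℂ} (hz : ‖z‖ = 1) (Y : Matrix (k × l) (k × l) ℂ)
    {p q : ℝ} (hp : p ∈ Set.Icc 1 2) (hq : 0 ≤ q) :
    clNorm p q ((1 / 2 : ℝ) • (star z • Y + z • Yᴴ)) ≤ clNorm p q Y := by
  have hzz : z * (starRingEnd ℂ) z = 1 := by simp [Complex.mul_conj', hz]
  have h1 : (!![1, 0; 0, z] : Matrix (Fin 2) (Fin 2) ℂ) ∈ Matrix.unitaryGroup (Fin 2) ℂ := by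
    rw [Matrix.mem_unitaryGroup_iff]
    ext i j
    fin_cases i <;> fin_cases j <;>
      simp [Matrix.mul_apply, Fin.sum_univ_two, Matrix.star_apply, hzz]
  have h2 : (!![0, z; 1, 0] : Matrix (Fin 2) (Fin 2) ℂ) ∈ Matrix.unitaryGroup (Fin 2) ℂ := by
    rw [Matrix.mem_unitaryGroup_iff]
    ext i j
    fin_cases i <;> fin_cases j <;>
      simp [Matrix.mul_apply, Fin.sum_univ_two, Matrix.star_apply, hzz]
  rw [clNorm, clNorm, ← insideAverage_clBlock]
  exact mul_le_mul_of_nonneg_left (tripleNorm_insideAverage_le (one_kronecker_mem_unitaryGroup h1)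
    (one_kronecker_mem_unitaryGroup h2) (isHermitian_clBlock Y) hp hq) (by norm_num)

end CarlenLieb

/-- **The Carlen–Lieb norm dominates the norms of the Hermitian real and imaginary parts**:
for Hermitian `Y₁, Y₂`, `‖Y₁ + i Y₂‖_CL ≥ ‖Y₁‖_CL` and `‖Y₁ + i Y₂‖_CL ≥ ‖Y₂‖_CL`. -/
theorem clNorm_ge_parts {n m : ℕ} (hn : 0 < n) (hm : 0 < m) (p q : ℝ)
    (hp1 : 1 ≤ p) (hp2 : p ≤ 2) (hq : 1 ≤ q)
    (Y₁ Y₂ : Matrix (Fin n × Fin m) (Fin n × Fin m) ℂ)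
    (h1 : Y₁.IsHermitian) (h2 : Y₂.IsHermitian) :
    clNorm p q Y₁ ≤ clNorm p q (Y₁ + Complex.I • Y₂) ∧
      clNorm p q Y₂ ≤ clNorm p q (Y₁ + Complex.I • Y₂) := by
  have hq0 : 0 ≤ q := zero_le_one.trans hq
  constructor
  · convert clNorm_hermitianPart_le (z := 1) (by simp) (Y₁ + Complex.I • Y₂) ⟨hp1, hp2⟩ hq0
      using 2
    ext i j
    simp [h1.eq, h2.eq]
    ring
  · convert clNorm_hermitianPart_le (z := Complex.I) (by simp) (Y₁ + Complex.I • Y₂) ⟨hp1, hp2⟩ hq0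
      using 2
    ext i j
    simp [h1.eq, h2.eq]
    linear_combination Y₂ i j * Complex.I_mul_I
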